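/- arXiv:2401.16368 — 3 statements merged into one kernel-verified Lean document; each statement's English description precedes it below -/
import Mathlib

section
/- Let τ₀ > 0 be real, let N ∈ ℕ, let c₁,…,c_N ≥ 0 and a₁,…,a_N ≥ 0 be real numbers, and let ω ∈ ℂ with Im(ω²) < 0 (so ω² ≠ a_l² for all l). Then Im(−ω² · τ₀ · (1 + Σ_{l=1}^N c_l²/(a_l² − ω²))) ≥ τ₀ · (−Im(ω²)) > 0. -/
open Finset

/-- A single Lorentz term `-z·s/(t - z)` with `s, t ≥ 0` maps the closed lower half plane
to the closed upper half plane. -/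
theorem lorentz_term_im_nonneg {s t : ℝ} (hs : 0 ≤ s) (ht : 0 ≤ t) {z : ℂ} (hz : z.im ≤ 0) :
    0 ≤ (-z * ((s : ℂ) / ((t : ℂ) - z))).im := by
  have h : (-z * ((s : ℂ) / ((t : ℂ) - z))).im = s * t * (-z.im) / Complex.normSq (t - z) := by
    simp only [Complex.mul_im, Complex.div_re, Complex.div_im, Complex.neg_re, Complex.neg_im,
      Complex.ofReal_re, Complex.ofReal_im, Complex.sub_re, Complex.sub_im]
    ring
  rw [h]
  exact div_nonneg (mul_nonneg (mul_nonneg hs ht) (neg_nonneg.mpr hz)) (Complex.normSq_nonneg _)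

/-- For a generalized Lorentz law `τ(ω) = τ₀·(1 + Σ c_l²/(a_l² − ω²))` with `τ₀ > 0`,
`c_l, a_l ≥ 0` and `Im(ω²) < 0`, one has
`Im(−ω²·τ(ω)) ≥ τ₀·(−Im(ω²)) > 0`. -/
theorem lorentz_law_neg_omega_sq_im_pos (τ₀ : ℝ) (hτ₀ : 0 < τ₀) (N : ℕ)
    (c a : Fin N → ℝ) (hc : ∀ l, 0 ≤ c l) (ha : ∀ l, 0 ≤ a l)
    (ω : ℂ) (hω : (ω ^ 2).im < 0) :
    τ₀ * (-(ω ^ 2).im) ≤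
      (-ω ^ 2 * (τ₀ : ℂ) * (1 + ∑ l, ((c l : ℂ)) ^ 2 / (((a l : ℂ)) ^ 2 - ω ^ 2))).im ∧
    0 < τ₀ * (-(ω ^ 2).im) := by
  refine ⟨?_, mul_pos hτ₀ (neg_pos.mpr hω)⟩
  have hsum : 0 ≤ (∑ l, -ω ^ 2 * ((c l : ℂ) ^ 2 / ((a l : ℂ) ^ 2 - ω ^ 2))).im := by
    rw [Complex.im_sum]
    refine sum_nonneg fun l _ => ?_
    simpa using lorentz_term_im_nonneg (sq_nonneg (c l)) (sq_nonneg (a l)) hω.le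
  have hsplit : -ω ^ 2 * (τ₀ : ℂ) * (1 + ∑ l, (c l : ℂ) ^ 2 / ((a l : ℂ) ^ 2 - ω ^ 2)) =
      (τ₀ : ℂ) * (-ω ^ 2 + ∑ l, -ω ^ 2 * ((c l : ℂ) ^ 2 / ((a l : ℂ) ^ 2 - ω ^ 2))) := by
    rw [← mul_sum]
    ring
  rw [hsplit, Complex.im_ofReal_mul, Complex.add_im, Complex.neg_im]
  exact mul_le_mul_of_nonneg_left (le_add_of_nonneg_right hsum) hτ₀.le
end

section
/- Let H be a real Hilbert space, let A : H → H be a bounded self-adjoint linear operator, and let s₁, s₂, m > 0 and r ≥ 0 be real numbers such that s₁‖f‖² ≤ ⟨Af, f⟩ ≤ s₂‖f‖² for all f ∈ H and s₂·r² < m. Then there exists α > 0 such that for all f, g ∈ H and all y ≥ 0 with ⟨Ag, g⟩ ≤ s₂·r²·y², one has ⟨Af, f⟩ + m·y² − 2⟨Af, g⟩ ≥ α·(‖f‖² + y²). -/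
open scoped RealInnerProductSpace

/-- Young's inequality with parameter `η > 0` for the quadratic form of a self-adjoint operator
with nonnegative quadratic form. -/
theorem IsSelfAdjoint.two_mul_inner_le_young {H : Type*} [NormedAddCommGroup H]
    [InnerProductSpace ℝ H] [CompleteSpace H] {A : H →L[ℝ] H} (hA : IsSelfAdjoint A)
    (hpos : ∀ f : H, 0 ≤ ⟪A f, f⟫) {η : ℝ} (hη : 0 < η) (f g : H) :
    2 * ⟪A f, g⟫ ≤ η * ⟪A f, f⟫ + ⟪A g, g⟫ / η := by
  have hsymm : ⟪A g, f⟫ = ⟪A f, g⟫ := by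
    rw [real_inner_comm]
    exact (hA.isSymmetric f g).symm
  have h := hpos (η • f - g)
  simp only [map_sub, map_smul, inner_sub_left, inner_sub_right, real_inner_smul_left,
    real_inner_smul_right, hsymm] at h
  refine le_of_mul_le_mul_left ?_ hη
  rw [mul_add, mul_div_cancel₀ _ hη.ne']
  linarith

/-- Coercivity estimate at the core of the proof of weak `T`-coercivity:
if `A` is a bounded self-adjoint operator with `s₁‖f‖² ≤ ⟨Af,f⟩ ≤ s₂‖f‖²` and the
contrast condition `s₂·r² < m` holds, then there is `α > 0` such that for all
`f, g` and `y ≥ 0` with `⟨Ag,g⟩ ≤ s₂·r²·y²`,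
`⟨Af,f⟩ + m·y² − 2⟨Af,g⟩ ≥ α·(‖f‖² + y²)`. -/
theorem coercivity_estimate {H : Type*} [NormedAddCommGroup H]
    [InnerProductSpace ℝ H] [CompleteSpace H]
    (A : H →L[ℝ] H) (hA : IsSelfAdjoint A)
    (s₁ s₂ m r : ℝ) (hs₁ : 0 < s₁) (hs₂ : 0 < s₂) (hm : 0 < m) (hr : 0 ≤ r)
    (hlow : ∀ f : H, s₁ * ‖f‖ ^ 2 ≤ ⟪A f, f⟫)
    (hup : ∀ f : H, ⟪A f, f⟫ ≤ s₂ * ‖f‖ ^ 2)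
    (hcontrast : s₂ * r ^ 2 < m) :
    ∃ α > 0, ∀ f g : H, ∀ y : ℝ, 0 ≤ y → ⟪A g, g⟫ ≤ s₂ * r ^ 2 * y ^ 2 →
      α * (‖f‖ ^ 2 + y ^ 2) ≤ ⟪A f, f⟫ + m * y ^ 2 - 2 * ⟪A f, g⟫ := by
  have hc : 0 ≤ s₂ * r ^ 2 := by positivity
  set c := s₂ * r ^ 2
  obtain ⟨η, hη₀, hη₁, hcη⟩ : ∃ η : ℝ, 0 < η ∧ η < 1 ∧ c / η < m := by
    have hη₀ : 0 < (c + m) / (2 * m) := by positivity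
    refine ⟨(c + m) / (2 * m), hη₀, ?_, ?_⟩
    · rw [div_lt_one (by positivity)]
      linarith
    · rw [div_lt_iff₀ hη₀]
      have : m * ((c + m) / (2 * m)) = (c + m) / 2 := by field_simp
      linarith
  have hpos (f : H) : 0 ≤ ⟪A f, f⟫ := le_trans (by positivity) (hlow f)
  refine ⟨min ((1 - η) * s₁) (m - c / η),
    lt_min (mul_pos (sub_pos.2 hη₁) hs₁) (sub_pos.2 hcη), fun f g y _ hg => ?_⟩
  have hyoung := hA.two_mul_inner_le_young hpos hη₀ f g
  have hgη : ⟪A g, g⟫ / η ≤ c / η * y ^ 2 := by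
    rw [div_mul_eq_mul_div]
    gcongr
  have hf := mul_le_mul_of_nonneg_left (hlow f) (sub_pos.2 hη₁).le
  have h₁ := mul_le_mul_of_nonneg_right (min_le_left ((1 - η) * s₁) (m - c / η))
    (sq_nonneg ‖f‖)
  have h₂ := mul_le_mul_of_nonneg_right (min_le_right ((1 - η) * s₁) (m - c / η))
    (sq_nonneg y)
  linarith
end

section
/- Let 0 < δ < r and let φ : ℝ² \ {0} → ℝ² be the reflection across the circle of radius r, φ(x) = (2r/‖x‖ − 1)·x. Then for every continuously differentiable function w : ℝ² → ℝ, ∫_{{x : r < ‖x‖ < r+δ}} ‖D(w∘φ)(x)‖² dx ≤ ((r+δ)/(r−δ))² · ∫_{{x : r−δ < ‖x‖ < r}} ‖Dw(x)‖² dx, where D denotes the Fréchet derivative, ‖·‖ its operator norm, and the integrals are with respect to Lebesgue measure on ℝ². -/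
open MeasureTheory

section RadialReflection

variable {E : Type*} [NormedAddCommGroup E] [InnerProductSpace ℝ E]

/-- The derivative at `x ≠ 0` of the radial reflection `y ↦ (2r/‖y‖ - 1) • y`. -/
noncomputable def radialReflectionFDeriv (r : ℝ) (x : E) : E →L[ℝ] E :=
  (2 * r / ‖x‖ - 1) • ContinuousLinearMap.id ℝ E +
    ((-(2 * r / ‖x‖ ^ 3)) • innerSL ℝ x).smulRight x

theorem radialReflectionFDeriv_apply (r : ℝ) (x v : E) :
    radialReflectionFDeriv r x v =
      (2 * r / ‖x‖ - 1) • v + (-(2 * r / ‖x‖ ^ 3) * inner ℝ x v) • x := by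
  simp [radialReflectionFDeriv]

theorem hasFDerivAt_norm_of_ne_zero {x : E} (hx : x ≠ 0) :
    HasFDerivAt (fun y : E => ‖y‖) (‖x‖⁻¹ • innerSL ℝ x) x := by
  have hx' : ‖x‖ ≠ 0 := norm_ne_zero_iff.mpr hx
  have h := (hasStrictFDerivAt_norm_sq x).hasFDerivAt.sqrt (pow_ne_zero 2 hx')
  simp only [Real.sqrt_sq (norm_nonneg _)] at h
  convert h using 1
  ext v
  simp
  field_simp

theorem hasFDerivAt_radialReflection (r : ℝ) {x : E} (hx : x ≠ 0) :
    HasFDerivAt (fun y : E => (2 * r / ‖y‖ - 1) • y) (radialReflectionFDeriv r x) x := by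
  have hx' : ‖x‖ ≠ 0 := norm_ne_zero_iff.mpr hx
  have h := ((((hasDerivAt_inv hx').comp_hasFDerivAt x
    (hasFDerivAt_norm_of_ne_zero hx)).const_mul (2 * r)).sub_const 1).smul (hasFDerivAt_id x)
  simp only [Function.comp_def, ← div_eq_mul_inv] at h
  refine h.congr_fderiv ?_
  ext v
  rw [radialReflectionFDeriv_apply]
  simp
  congr 1
  field_simp

theorem norm_radialReflectionFDeriv_le_one {r : ℝ} {x : E} (hr : 0 < r) (hx : r ≤ ‖x‖) :
    ‖radialReflectionFDeriv r x‖ ≤ 1 := by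
  refine ContinuousLinearMap.opNorm_le_bound _ zero_le_one fun v => ?_
  have hρ : 0 < ‖x‖ := hr.trans_le hx
  rw [one_mul, ← sq_le_sq₀ (norm_nonneg _) (norm_nonneg _), radialReflectionFDeriv_apply,
    norm_add_sq_real, norm_smul, norm_smul, inner_smul_left, inner_smul_right,
    real_inner_comm x v, mul_pow, mul_pow, Real.norm_eq_abs, Real.norm_eq_abs, sq_abs, sq_abs]
  have hcs : inner ℝ x v ^ 2 ≤ ‖x‖ ^ 2 * ‖v‖ ^ 2 := by
    rw [← mul_pow, ← sq_abs]
    exact pow_le_pow_left₀ (abs_nonneg _) (abs_real_inner_le_norm x v) 2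
  have hk : 0 ≤ 4 * r * (‖x‖ - r) / ‖x‖ ^ 4 := by
    have : 0 ≤ ‖x‖ - r := sub_nonneg.mpr hx
    positivity
  have key := mul_le_mul_of_nonneg_left hcs hk
  have e : ‖v‖ ^ 2 = (2 * r / ‖x‖ - 1) ^ 2 * ‖v‖ ^ 2 +
      4 * r * (‖x‖ - r) / ‖x‖ ^ 4 * (‖x‖ ^ 2 * ‖v‖ ^ 2) := by
    field_simp
    ring
  rw [e]
  refine le_trans (le_of_eq ?_) (add_le_add_right key _)
  simp
  field_simp
  ring

theorem norm_radialReflection {r : ℝ} {x : E} (hx : x ≠ 0) (hxr : ‖x‖ ≤ 2 * r) :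
    ‖(2 * r / ‖x‖ - 1) • x‖ = 2 * r - ‖x‖ := by
  have hρ : 0 < ‖x‖ := norm_pos_iff.mpr hx
  have : 0 ≤ 2 * r / ‖x‖ - 1 := by
    rw [sub_nonneg, one_le_div hρ]
    exact hxr
  rw [norm_smul, Real.norm_of_nonneg this]
  field_simp

theorem radialReflection_radialReflection {r : ℝ} {x : E} (hx : x ≠ 0) (hxr : ‖x‖ < 2 * r) :
    (2 * r / ‖(2 * r / ‖x‖ - 1) • x‖ - 1) • ((2 * r / ‖x‖ - 1) • x) = x := by
  have hρ : ‖x‖ ≠ 0 := norm_ne_zero_iff.mpr hx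
  have hs : 2 * r - ‖x‖ ≠ 0 := (sub_pos.mpr hxr).ne'
  rw [norm_radialReflection hx hxr.le, smul_smul]
  convert one_smul ℝ x using 2
  field_simp
  ring

end RadialReflection

theorem det_radialReflectionFDeriv (r : ℝ) {x : EuclideanSpace ℝ (Fin 2)} (hx : x ≠ 0) :
    (radialReflectionFDeriv r x).det = -(2 * r / ‖x‖ - 1) := by
  have hρ : ‖x‖ ≠ 0 := norm_ne_zero_iff.mpr hx
  have hsq : ‖x‖ ^ 2 = x 0 ^ 2 + x 1 ^ 2 := by
    simp [EuclideanSpace.norm_sq_eq]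
  rw [ContinuousLinearMap.det,
    ← LinearMap.det_toMatrix (EuclideanSpace.basisFun (Fin 2) ℝ).toBasis, Matrix.det_fin_two]
  simp [LinearMap.toMatrix_apply, radialReflectionFDeriv_apply, EuclideanSpace.inner_single_right]
  have : (2 * r / ‖x‖ - 1) * ((2 * r / ‖x‖ - 1) - 2 * r / ‖x‖ ^ 3 * (x 0 ^ 2 + x 1 ^ 2)) =
      -(2 * r / ‖x‖ - 1) := by
    rw [← hsq]
    field_simp
    ring
  linear_combination this

theorem image_radialReflection_annulus {E : Type*} [NormedAddCommGroup E]
    [InnerProductSpace ℝ E] {r δ : ℝ} (hδr : δ < r) :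
    (fun x : E => (2 * r / ‖x‖ - 1) • x) '' {x : E | r < ‖x‖ ∧ ‖x‖ < r + δ} =
      {x : E | r - δ < ‖x‖ ∧ ‖x‖ < r} := by
  ext y
  constructor
  · rintro ⟨x, ⟨h1, h2⟩, rfl⟩
    have hx : x ≠ 0 := norm_pos_iff.mp (by linarith)
    simp only [Set.mem_ofPred_eq]
    rw [norm_radialReflection hx (by linarith)]
    constructor <;> linarith
  · rintro ⟨h1, h2⟩
    have hy : y ≠ 0 := norm_pos_iff.mp (by linarith)
    refine ⟨(2 * r / ‖y‖ - 1) • y, ?_, radialReflection_radialReflection hy (by linarith)⟩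
    simp only [Set.mem_ofPred_eq]
    rw [norm_radialReflection hy (by linarith)]
    constructor <;> linarith

/-- Bound for the global reflection operator `R₋` at a circular interface in 2D:
with `φ(x) = (2r/‖x‖ − 1)·x` the reflection across the circle of radius `r`, for every
`C¹` function `w` one has
`∫_{r<‖x‖<r+δ} ‖D(w∘φ)‖² ≤ ((r+δ)/(r−δ))² ∫_{r−δ<‖x‖<r} ‖Dw‖²`. -/
theorem circle_reflection_energy_bound_inner_to_outer (r δ : ℝ) (hδ : 0 < δ) (hδr : δ < r)
    (φ : EuclideanSpace ℝ (Fin 2) → EuclideanSpace ℝ (Fin 2))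
    (hφ : ∀ x : EuclideanSpace ℝ (Fin 2), x ≠ 0 → φ x = (2 * r / ‖x‖ - 1) • x)
    (w : EuclideanSpace ℝ (Fin 2) → ℝ) (hw : ContDiff ℝ 1 w) :
    ∫ x in {x : EuclideanSpace ℝ (Fin 2) | r < ‖x‖ ∧ ‖x‖ < r + δ},
        ‖fderiv ℝ (w ∘ φ) x‖ ^ 2 ≤
      ((r + δ) / (r - δ)) ^ 2 *
        ∫ x in {x : EuclideanSpace ℝ (Fin 2) | r - δ < ‖x‖ ∧ ‖x‖ < r},
          ‖fderiv ℝ w x‖ ^ 2 := by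
  have hr : 0 < r := hδ.trans hδr
  set S := {x : EuclideanSpace ℝ (Fin 2) | r < ‖x‖ ∧ ‖x‖ < r + δ} with hS
  have hS0 : ∀ x ∈ S, x ≠ 0 := fun x hx => norm_pos_iff.mp (hr.trans hx.1)
  have hSm : MeasurableSet S :=
    ((isOpen_lt continuous_const continuous_norm).inter
      (isOpen_lt continuous_norm continuous_const)).measurableSet
  have hφ' : ∀ x ∈ S, HasFDerivAt φ (radialReflectionFDeriv r x) x := fun x hx =>
    (hasFDerivAt_radialReflection r (hS0 x hx)).congr_of_eventuallyEq
      (Filter.mem_of_superset (isOpen_ne.mem_nhds (hS0 x hx)) hφ)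
  have himg : φ '' S = {x : EuclideanSpace ℝ (Fin 2) | r - δ < ‖x‖ ∧ ‖x‖ < r} := by
    rw [← image_radialReflection_annulus hδr]
    exact Set.image_congr fun x hx => hφ x (hS0 x hx)
  have hinj : Set.InjOn φ S := by
    refine Set.LeftInvOn.injOn (f₁' := fun y => (2 * r / ‖y‖ - 1) • y) fun x hx => ?_
    rw [hφ x (hS0 x hx)]
    exact radialReflection_radialReflection (hS0 x hx) (by linarith [hx.2])
  have hcont : Continuous fun y => ‖fderiv ℝ w y‖ ^ 2 :=
    (hw.continuous_fderiv one_ne_zero).norm.pow 2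
  have hint : IntegrableOn (fun y => ‖fderiv ℝ w y‖ ^ 2) (φ '' S) := by
    rw [himg]
    refine (hcont.continuousOn.integrableOn_compact
      (isCompact_closedBall (0 : EuclideanSpace ℝ (Fin 2)) r)).mono_set fun y hy => ?_
    simpa using hy.2.le
  rw [← himg, integral_image_eq_integral_abs_det_fderiv_smul volume hSm
    (fun x hx => (hφ' x hx).hasFDerivWithinAt) hinj, ← integral_const_mul]
  rw [integrableOn_image_iff_integrableOn_abs_det_fderiv_smul volume hSm
    (fun x hx => (hφ' x hx).hasFDerivWithinAt) hinj] at hint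
  refine integral_mono_of_nonneg (ae_of_all _ fun x => sq_nonneg _) (hint.const_mul _)
    ((ae_restrict_mem hSm).mono fun x hx => ?_)
  have hρ : 0 < ‖x‖ := hr.trans hx.1
  have hchain : ‖fderiv ℝ (w ∘ φ) x‖ ≤ ‖fderiv ℝ w (φ x)‖ := by
    rw [(((hw.differentiable one_ne_zero) (φ x)).hasFDerivAt.comp x (hφ' x hx)).fderiv]
    exact (ContinuousLinearMap.opNorm_comp_le _ _).trans
      (mul_le_of_le_one_right (norm_nonneg _)
        (norm_radialReflectionFDeriv_le_one hr hx.1.le))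
  have hq : 1 ≤ (r + δ) / (r - δ) := by
    rw [one_le_div (by linarith)]
    linarith
  have hs : (r - δ) / (r + δ) ≤ 2 * r / ‖x‖ - 1 := by
    rw [div_le_iff₀ (by linarith), sub_mul, one_mul, div_mul_eq_mul_div, le_sub_iff_add_le,
      le_div_iff₀ hρ]
    nlinarith [hx.2]
  have hs0 : 0 < (r - δ) / (r + δ) := div_pos (by linarith) (by linarith)
  have hdet : 1 ≤ ((r + δ) / (r - δ)) ^ 2 * (2 * r / ‖x‖ - 1) := calc
    (1 : ℝ) ≤ (r + δ) / (r - δ) := hq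
    _ = ((r + δ) / (r - δ)) ^ 2 * ((r - δ) / (r + δ)) := by
      have : r - δ ≠ 0 := (sub_pos.mpr hδr).ne'
      field_simp
    _ ≤ _ := by gcongr
  simp only [smul_eq_mul]
  rw [det_radialReflectionFDeriv r (hS0 x hx), abs_neg, abs_of_pos (hs0.trans_le hs), ← mul_assoc]
  exact (pow_le_pow_left₀ (norm_nonneg _) hchain 2).trans
    (le_mul_of_one_le_left (sq_nonneg _) hdet)
end
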